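/- arXiv:q-alg/9505022 — 2 statements merged into one kernel-verified Lean document; each statement's English description precedes it below -/
import Mathlib

section
/- Let 𝔤 be a Lie algebra and V a vector space, and let 𝔞 be the Lie algebra freely generated by 𝔤 and V. Then the Lie subalgebra of 𝔞 generated by U(𝔤)·V (the 𝔤-submodule of 𝔞 generated by V) is isomorphic to the free Lie algebra F(U(𝔤)·V) on the vector space U(𝔤)·V. -/
open TensorProduct

namespace UgVFree

/-- The Lie algebra `L[ε]` of dual numbers over `L`, as a type synonym of `L × L`. -/
def DualLie (L : Type*) : Type _ := L × L

section Dual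
variable {F L : Type*} [Field F] [LieRing L] [LieAlgebra F L]

instance : AddCommGroup (DualLie L) := inferInstanceAs (AddCommGroup (L × L))
instance : Module F (DualLie L) := inferInstanceAs (Module F (L × L))

theorem DualLie.ext' {x y : DualLie L} (h1 : x.1 = y.1) (h2 : x.2 = y.2) : x = y :=
  Prod.ext h1 h2

/-- Constructor for `DualLie`. -/
def DualLie.mk (a b : L) : DualLie L := (a, b)

instance : Bracket (DualLie L) (DualLie L) where
  bracket x y := (⁅x.1, y.1⁆, ⁅x.1, y.2⁆ + ⁅x.2, y.1⁆)

theorem DualLie.add_fst (x y : DualLie L) : (x + y).1 = x.1 + y.1 := rfl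
theorem DualLie.add_snd (x y : DualLie L) : (x + y).2 = x.2 + y.2 := rfl
theorem DualLie.zero_fst : (0 : DualLie L).1 = 0 := rfl
theorem DualLie.zero_snd : (0 : DualLie L).2 = 0 := rfl
theorem DualLie.smul_fst (c : F) (x : DualLie L) : (c • x).1 = c • x.1 := rfl
theorem DualLie.smul_snd (c : F) (x : DualLie L) : (c • x).2 = c • x.2 := rfl
theorem DualLie.lie_fst (x y : DualLie L) : ⁅x, y⁆.1 = ⁅x.1, y.1⁆ := rfl
theorem DualLie.lie_snd (x y : DualLie L) : ⁅x, y⁆.2 = ⁅x.1, y.2⁆ + ⁅x.2, y.1⁆ := rfl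

instance : LieRing (DualLie L) where
  add_lie x y z := by
    apply DualLie.ext' <;>
      simp only [DualLie.add_fst, DualLie.add_snd, DualLie.lie_fst, DualLie.lie_snd, add_lie]
    abel
  lie_add x y z := by
    apply DualLie.ext' <;>
      simp only [DualLie.add_fst, DualLie.add_snd, DualLie.lie_fst, DualLie.lie_snd, lie_add]
    abel
  lie_self x := by
    apply DualLie.ext' <;>
      simp only [DualLie.zero_fst, DualLie.zero_snd, DualLie.lie_fst, DualLie.lie_snd, lie_self]
    rw [← lie_skew x.2 x.1]; exact add_neg_cancel (⁅x.1, x.2⁆ : L)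
  leibniz_lie x y z := by
    apply DualLie.ext' <;>
      simp only [DualLie.add_fst, DualLie.add_snd, DualLie.lie_fst, DualLie.lie_snd, lie_add,
        add_lie]
    · exact leibniz_lie _ _ _
    · rw [leibniz_lie x.1 y.1 z.2, leibniz_lie x.1 y.2 z.1, leibniz_lie x.2 y.1 z.1]; abel

instance : LieAlgebra F (DualLie L) where
  lie_smul c x y := by
    apply DualLie.ext' <;>
      simp only [DualLie.smul_fst, DualLie.smul_snd, DualLie.lie_fst, DualLie.lie_snd, lie_smul,
        smul_add]

end Dual

section Free
variable {F : Type*} [Field F] {X : Type*}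

/-- Lift of generators to dual numbers. -/
noncomputable def dualLift (d : X → FreeLieAlgebra F X) :
    FreeLieAlgebra F X →ₗ⁅F⁆ DualLie (FreeLieAlgebra F X) :=
  FreeLieAlgebra.lift F fun x => DualLie.mk (FreeLieAlgebra.of F x) (d x)

/-- First projection from the dual numbers. -/
def dualFst (L : Type*) [LieRing L] [LieAlgebra F L] : DualLie L →ₗ⁅F⁆ L where
  toFun x := x.1
  map_add' _ _ := rfl
  map_smul' _ _ := rfl
  map_lie' := rfl

theorem dualLift_fst (d : X → FreeLieAlgebra F X) (a : FreeLieAlgebra F X) :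
    (dualLift d a).1 = a := by
  have : (dualFst (F := F) _).comp (dualLift d) = LieHom.id := by
    apply FreeLieAlgebra.hom_ext
    intro x
    change (dualLift d _).1 = _
    rw [dualLift, FreeLieAlgebra.lift_of_apply]
    rfl
  exact LieHom.congr_fun this a

/-- The derivation of the free Lie algebra with prescribed values on generators. -/
noncomputable def freeDer (d : X → FreeLieAlgebra F X) :
    LieDerivation F (FreeLieAlgebra F X) (FreeLieAlgebra F X) where
  toFun a := (dualLift d a).2
  map_add' a b := by rw [map_add]; rfl
  map_smul' c a := by rw [map_smul]; rfl
  leibniz' a b := by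
    change (dualLift d ⁅a, b⁆).2 = ⁅a, (dualLift d b).2⁆ - ⁅b, (dualLift d a).2⁆
    rw [LieHom.map_lie, DualLie.lie_snd, dualLift_fst, dualLift_fst, sub_eq_add_neg, lie_skew]

theorem freeDer_of (d : X → FreeLieAlgebra F X) (x : X) :
    freeDer d (FreeLieAlgebra.of F x) = d x := by
  change (dualLift d _).2 = _
  rw [dualLift, FreeLieAlgebra.lift_of_apply]
  rfl

theorem free_span :
    LieSubalgebra.lieSpan F (FreeLieAlgebra F X) (Set.range (FreeLieAlgebra.of F)) = ⊤ := by
  rw [eq_top_iff]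
  intro a _
  let S := LieSubalgebra.lieSpan F (FreeLieAlgebra F X) (Set.range (FreeLieAlgebra.of F))
  let l : FreeLieAlgebra F X →ₗ⁅F⁆ S := FreeLieAlgebra.lift F
    fun x => ⟨FreeLieAlgebra.of F x, LieSubalgebra.subset_lieSpan ⟨x, rfl⟩⟩
  have : S.incl.comp l = LieHom.id := by
    apply FreeLieAlgebra.hom_ext
    intro x
    simp [l]
  have h2 : ((l a : S) : FreeLieAlgebra F X) = a := LieHom.congr_fun this a
  rw [← h2]
  exact (l a).2

theorem der_ext {D₁ D₂ : LieDerivation F (FreeLieAlgebra F X) (FreeLieAlgebra F X)}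
    (h : ∀ x, D₁ (FreeLieAlgebra.of F x) = D₂ (FreeLieAlgebra.of F x)) : D₁ = D₂ :=
  LieDerivation.ext_of_lieSpan_eq_top _ free_span (by rintro _ ⟨x, rfl⟩; exact h x)

variable {W : Type*} [AddCommGroup W] [Module F W] (b : Module.Basis X F W)

/-- The inclusion of the vector space into the free Lie algebra. -/
noncomputable def incW : W →ₗ[F] FreeLieAlgebra F X := b.constr F (FreeLieAlgebra.of F)

theorem incW_basis (x : X) : incW b (b x) = FreeLieAlgebra.of F x := by
  simp [incW]

/-- Extension of an endomorphism to a derivation. -/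
noncomputable def endDer (T : W →ₗ[F] W) :
    LieDerivation F (FreeLieAlgebra F X) (FreeLieAlgebra F X) :=
  freeDer fun x => incW b (T (b x))

theorem endDer_of (T : W →ₗ[F] W) (x : X) :
    endDer b T (FreeLieAlgebra.of F x) = incW b (T (b x)) := freeDer_of _ _

theorem endDer_inc (T : W →ₗ[F] W) (w : W) : endDer b T (incW b w) = incW b (T w) := by
  have : (endDer b T : FreeLieAlgebra F X →ₗ[F] FreeLieAlgebra F X) ∘ₗ incW b
      = incW b ∘ₗ T := by
    apply b.ext
    intro x
    simp [incW_basis, endDer_of]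
  exact LinearMap.congr_fun this w

/-- A representation extends to an action by derivations. -/
noncomputable def actDer {G : Type*} [LieRing G] [LieAlgebra F G] (ρ : G →ₗ[F] W →ₗ[F] W)
    (hρ : ∀ x y w, ρ ⁅x, y⁆ w = ρ x (ρ y w) - ρ y (ρ x w)) :
    G →ₗ⁅F⁆ LieDerivation F (FreeLieAlgebra F X) (FreeLieAlgebra F X) where
  toFun x := endDer b (ρ x)
  map_add' x y := by
    apply der_ext; intro i
    rw [LieDerivation.add_apply]
    simp only [endDer_of, map_add, LinearMap.add_apply]
  map_smul' c x := by
    apply der_ext; intro i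
    rw [RingHom.id_apply, LieDerivation.smul_apply]
    simp only [endDer_of, map_smul, LinearMap.smul_apply]
  map_lie' := by
    intro x y
    apply der_ext; intro i
    rw [LieDerivation.lie_apply]
    simp only [endDer_of, endDer_inc, hρ, map_sub]

end Free

section Shr
universe u v w
variable {F : Type v} [Field F] (S : Type w) [LieRing S] [LieAlgebra F S] [Small.{u} S]

noncomputable instance : LieRing (Shrink.{u} S) where
  bracket x y := equivShrink S ⁅(equivShrink S).symm x, (equivShrink S).symm y⁆
  add_lie x y z := by
    apply (equivShrink S).symm.injective
    simp only [equivShrink_symm_add, Equiv.symm_apply_apply, add_lie]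
  lie_add x y z := by
    apply (equivShrink S).symm.injective
    simp only [equivShrink_symm_add, Equiv.symm_apply_apply, lie_add]
  lie_self x := by
    apply (equivShrink S).symm.injective
    simp only [equivShrink_symm_zero, Equiv.symm_apply_apply, lie_self]
  leibniz_lie x y z := by
    apply (equivShrink S).symm.injective
    simp only [equivShrink_symm_add, Equiv.symm_apply_apply]
    exact leibniz_lie _ _ _

theorem shr_lie (x y : Shrink.{u} S) :
    ⁅x, y⁆ = equivShrink S ⁅(equivShrink S).symm x, (equivShrink S).symm y⁆ := rfl

noncomputable instance : LieAlgebra F (Shrink.{u} S) where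
  lie_smul c x y := by
    apply (equivShrink S).symm.injective
    simp only [shr_lie, equivShrink_symm_smul, Equiv.symm_apply_apply, lie_smul]

variable (F) in
/-- The comparison of a small Lie algebra with its shrunk copy. -/
noncomputable def shrTo : S →ₗ⁅F⁆ Shrink.{u} S where
  toFun := equivShrink S
  map_add' x y := by apply (equivShrink S).symm.injective; simp
  map_smul' c x := by apply (equivShrink S).symm.injective; simp
  map_lie' := by intro x y; simp [shr_lie]

variable (F) in
/-- The inverse of `shrTo`. -/
noncomputable def shrFrom : Shrink.{u} S →ₗ⁅F⁆ S where
  toFun := (equivShrink S).symm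
  map_add' x y := by simp
  map_smul' c x := by simp
  map_lie' := by intro x y; simp [shr_lie]

theorem shrFrom_shrTo (x : S) : shrFrom.{u} F S (shrTo.{u} F S x) = x := by
  simp [shrFrom, shrTo]

theorem small_free (X : Type u) [Small.{u} F] : Small.{u} (FreeLieAlgebra F X) := by
  have h1 : Small.{u} (FreeMagma X →₀ F) :=
    small_of_injective (β := FreeMagma X → F) DFunLike.coe_injective
  have h2 : Small.{u} (FreeNonUnitalNonAssocAlgebra F X) :=
    small_of_surjective (f := fun c : FreeMagma X →₀ F => MonoidAlgebra.ofCoeff c)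
      (fun ⟨c⟩ => ⟨c, rfl⟩)
  exact small_of_surjective (α := FreeNonUnitalNonAssocAlgebra F X) (f := Quot.mk _)
    Quot.mk_surjective

theorem small_semi {G L : Type*} [LieRing G] [LieAlgebra F G] [LieRing L] [LieAlgebra F L]
    (ψ : G →ₗ⁅F⁆ LieDerivation F L L) [Small.{u} G] [Small.{u} L] :
    Small.{u} (LieAlgebra.SemiDirectSum L G ψ) :=
  small_of_injective (LieAlgebra.SemiDirectSum.toProd (ψ := ψ)).injective

end Shr

end UgVFree



/-- let `𝔞` be the Lie algebra freely generated by a Lie algebra `𝔤` and a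
vector space `V`.  Then the Lie subalgebra of `𝔞` generated by the `𝔤`-submodule
`U(𝔤)·V` (the `𝔤`-submodule generated by `V`) is the free Lie algebra on the vector
space `U(𝔤)·V`: it satisfies the universal property of the free Lie algebra. -/
theorem lie_subalgebra_on_UgV_is_free
    (F : Type*) (𝔤 V 𝔞 : Type u) [Field F] [LieRing 𝔤] [LieAlgebra F 𝔤]
    [AddCommGroup V] [Module F V] [LieRing 𝔞] [LieAlgebra F 𝔞]
    (ι𝔤 : 𝔤 →ₗ⁅F⁆ 𝔞) (ιV : V →ₗ[F] 𝔞)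
    (hUP : ∀ (K : Type u) (_ : LieRing K) (_ : LieAlgebra F K)
        (f : 𝔤 →ₗ⁅F⁆ K) (g : V →ₗ[F] K),
      ∃! φ : 𝔞 →ₗ⁅F⁆ K, (∀ x, φ (ι𝔤 x) = f x) ∧ (∀ v, φ (ιV v) = g v))
    (W : Submodule F 𝔞)
    (hW : W = sInf {p : Submodule F 𝔞 |
      LinearMap.range ιV ≤ p ∧ ∀ (x : 𝔤), ∀ a ∈ p, ⁅ι𝔤 x, a⁆ ∈ p}) :
    ∀ (K : Type u) (_ : LieRing K) (_ : LieAlgebra F K) (g : W →ₗ[F] K),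
      ∃! ψ : (LieSubalgebra.lieSpan F 𝔞 (W : Set 𝔞)) →ₗ⁅F⁆ K,
        ∀ (w : 𝔞) (hw : w ∈ W),
          ψ ⟨w, LieSubalgebra.subset_lieSpan hw⟩ = g ⟨w, hw⟩ := by
  intro K _ _ g
  have hV : ∀ v, ιV v ∈ W := by
    intro v
    rw [hW, Submodule.mem_sInf]
    intro p hp
    exact hp.1 ⟨v, rfl⟩
  have hG : ∀ x, ∀ a ∈ W, ⁅ι𝔤 x, a⁆ ∈ W := by
    intro x a ha
    rw [hW, Submodule.mem_sInf] at ha ⊢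
    intro p hp
    exact hp.2 x a (ha p hp)
  have hmin : ∀ p : Submodule F 𝔞, (∀ v, ιV v ∈ p) → (∀ x, ∀ a ∈ p, ⁅ι𝔤 x, a⁆ ∈ p) → W ≤ p := by
    intro p h1 h2
    rw [hW]
    exact sInf_le ⟨by rintro _ ⟨v, rfl⟩; exact h1 v, h2⟩
  clear hW
  -- uniqueness
  have huniq : ∀ ψ₁ ψ₂ : (LieSubalgebra.lieSpan F 𝔞 (W : Set 𝔞)) →ₗ⁅F⁆ K,
      (∀ (w : 𝔞) (hw : w ∈ W), ψ₁ ⟨w, LieSubalgebra.subset_lieSpan hw⟩ =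
        ψ₂ ⟨w, LieSubalgebra.subset_lieSpan hw⟩) → ψ₁ = ψ₂ := by
    intro ψ₁ ψ₂ h
    ext ⟨a, ha⟩
    induction ha using LieSubalgebra.lieSpan_induction with
    | mem a ha => exact h a ha
    | zero => exact (map_zero ψ₁).trans (map_zero ψ₂).symm
    | add a b ha hb iha ihb =>
      have := congrArg₂ (· + ·) iha ihb
      simp only [← map_add] at this
      exact this
    | smul c a ha iha =>
      have := congrArg (c • ·) iha
      simp only [← map_smul] at this
      exact this
    | lie a b ha hb iha ihb =>
      have := congrArg₂ (fun p q => ⁅p, q⁆) iha ihb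
      simp only [← LieHom.map_lie] at this
      exact this
  -- existence
  suffices hex : ∃ ψ : (LieSubalgebra.lieSpan F 𝔞 (W : Set 𝔞)) →ₗ⁅F⁆ K,
        ∀ (w : 𝔞) (hw : w ∈ W),
          ψ ⟨w, LieSubalgebra.subset_lieSpan hw⟩ = g ⟨w, hw⟩ by
    obtain ⟨ψ, hψ⟩ := hex
    refine ⟨ψ, hψ, fun ψ' hψ' => huniq _ _ fun w hw => ?_⟩
    rw [hψ, hψ' w hw]
  rcases subsingleton_or_nontrivial 𝔞 with hs | hn
  · refine ⟨0, fun w hw => ?_⟩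
    have : (⟨w, hw⟩ : W) = 0 := Subsingleton.elim _ _
    rw [this, map_zero]; rfl
  obtain ⟨a₀, ha₀⟩ := exists_ne (0 : 𝔞)
  have hF : Small.{u} F := small_of_injective (f := fun c : F => c • a₀)
    (smul_left_injective F ha₀)
  -- the representation on `W`
  let ρ : 𝔤 →ₗ[F] W →ₗ[F] W :=
    { toFun := fun x =>
        { toFun := fun w => ⟨⁅ι𝔤 x, (w : 𝔞)⁆, hG x w w.2⟩
          map_add' := fun a b => Subtype.ext (lie_add _ _ _)
          map_smul' := fun c a => Subtype.ext (lie_smul _ _ _) }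
      map_add' := fun x y => by
        ext w
        change ⁅ι𝔤 (x + y), (w : 𝔞)⁆ = ⁅ι𝔤 x, (w : 𝔞)⁆ + ⁅ι𝔤 y, (w : 𝔞)⁆
        rw [map_add, add_lie]
      map_smul' := fun c x => by
        ext w
        change ⁅ι𝔤 (c • x), (w : 𝔞)⁆ = c • ⁅ι𝔤 x, (w : 𝔞)⁆
        rw [map_smul, smul_lie] }
  have hρlie : ∀ x y w, ρ ⁅x, y⁆ w = ρ x (ρ y w) - ρ y (ρ x w) := by
    intro x y w
    apply Subtype.ext
    change ⁅ι𝔤 ⁅x, y⁆, (w : 𝔞)⁆ = ⁅ι𝔤 x, ⁅ι𝔤 y, (w : 𝔞)⁆⁆ - ⁅ι𝔤 y, ⁅ι𝔤 x, (w : 𝔞)⁆⁆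
    rw [LieHom.map_lie, lie_lie]
  have hρ : ∀ x w, ((ρ x w : W) : 𝔞) = ⁅ι𝔤 x, (w : 𝔞)⁆ := fun _ _ => rfl
  let b := Module.Basis.ofVectorSpace F W
  let j := UgVFree.incW b
  let δ := UgVFree.actDer b ρ hρlie
  have hδ : ∀ x w, δ x (j w) = j (ρ x w) := fun x w => UgVFree.endDer_inc b (ρ x) w
  have hs1 := UgVFree.small_free.{u} (F := F) (Module.Basis.ofVectorSpaceIndex F W)
  have hs2 := UgVFree.small_semi.{u} δ
  let inV : V →ₗ[F] LieAlgebra.SemiDirectSum _ 𝔤 δ :=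
    (LieAlgebra.SemiDirectSum.inl δ).toLinearMap ∘ₗ j ∘ₗ (ιV.codRestrict W hV)
  obtain ⟨Φ', ⟨hΦ1, hΦ2⟩, -⟩ := hUP (Shrink.{u} (LieAlgebra.SemiDirectSum _ 𝔤 δ))
    inferInstance inferInstance
    ((UgVFree.shrTo.{u} F _).comp (LieAlgebra.SemiDirectSum.inr δ))
    ((UgVFree.shrTo.{u} F (LieAlgebra.SemiDirectSum _ 𝔤 δ)).toLinearMap ∘ₗ inV)
  let Φ := (UgVFree.shrFrom.{u} F _).comp Φ'
  have hΦG : ∀ x, Φ (ι𝔤 x) = ⟨0, x⟩ := by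
    intro x
    change UgVFree.shrFrom.{u} F _ (Φ' _) = _
    rw [hΦ1]
    exact UgVFree.shrFrom_shrTo _ _
  have hΦV : ∀ v, Φ (ιV v) = ⟨j ⟨ιV v, hV v⟩, 0⟩ := by
    intro v
    change UgVFree.shrFrom.{u} F _ (Φ' _) = _
    rw [hΦ2]
    exact UgVFree.shrFrom_shrTo _ _
  clear_value Φ
  have hΦW : ∀ w (hw : w ∈ W), Φ w = ⟨j ⟨w, hw⟩, 0⟩ := by
    let p : Submodule F 𝔞 :=
      (LinearMap.eqLocus (Φ.toLinearMap ∘ₗ W.subtype)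
        ((LieAlgebra.SemiDirectSum.inl δ).toLinearMap ∘ₗ j)).map W.subtype
    have hp : ∀ w, w ∈ p ↔ ∃ hw : w ∈ W, Φ w = ⟨j ⟨w, hw⟩, 0⟩ := by
      intro w
      constructor
      · rintro ⟨w, h, rfl⟩
        exact ⟨w.2, h⟩
      · rintro ⟨hw, h⟩
        exact ⟨⟨w, hw⟩, h, rfl⟩
    have : W ≤ p := by
      apply hmin
      · intro v
        exact (hp _).2 ⟨hV v, hΦV v⟩
      · intro x a ha
        obtain ⟨ha, h⟩ := (hp _).1 ha
        refine (hp _).2 ⟨hG x a ha, ?_⟩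
        rw [LieHom.map_lie, hΦG, h, LieAlgebra.SemiDirectSum.lie_eq_mk]
        simp [hδ]
        rfl
    intro w hw
    exact ((hp w).1 (this hw)).2
  have hker : ∀ a ∈ LieSubalgebra.lieSpan F 𝔞 (W : Set 𝔞), (Φ a).right = 0 := by
    intro a ha
    change (LieAlgebra.SemiDirectSum.projr δ) (Φ a) = 0
    induction ha using LieSubalgebra.lieSpan_induction with
    | mem a ha => rw [hΦW a ha]; rfl
    | zero => simp only [map_zero]
    | add a b ha hb iha ihb => rw [map_add, map_add, iha, ihb, add_zero]
    | smul c a ha iha => rw [map_smul, map_smul, iha, smul_zero]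
    | lie a b ha hb iha ihb => rw [LieHom.map_lie, LieHom.map_lie, iha, zero_lie]
  let G := FreeLieAlgebra.lift F (fun i => g (b i))
  have hGj : ∀ w, G (j w) = g w := by
    intro w
    have : G.toLinearMap ∘ₗ j = g := by
      apply b.ext
      intro i
      simp [j, G, UgVFree.incW_basis]
    exact LinearMap.congr_fun this w
  refine ⟨{ toFun := fun a => G (Φ a).left
            map_add' := ?_, map_smul' := ?_, map_lie' := ?_ }, ?_⟩
  · intro x y
    simp
  · intro c x
    simp
  · intro x y
    change G (Φ ⁅(x : 𝔞), (y : 𝔞)⁆).left = _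
    rw [LieHom.map_lie, LieAlgebra.SemiDirectSum.lie_eq_mk, hker x x.2, hker y y.2]
    simp
  · intro w hw
    change G (Φ w).left = _
    rw [hΦW w hw, hGj]
end

section
/- Elimination theorem for free Lie algebras: Let V and W be vector spaces over a field F. Then the free Lie algebra F(V ⊕ W) decomposes as the semidirect product F(V ⊕ W) = F(T(W)·V) ⋊ F(W), where T(W)·V ⊆ F(V ⊕ W) is the T(W)-submodule generated by V under the adjoint action, F(T(W)·V) is the ideal of F(V ⊕ W) generated by V, and this ideal is a free Lie algebra on the vector space T(W)·V. -/
open TensorProduct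

/-- Functions on words in `X` with values in `K`; carries the coinduced (shuffle) Lie bracket. -/
def Coind (X K : Type*) : Type _ := List X → K

namespace Coind

variable {F X K : Type*} [Field F] [LieRing K] [LieAlgebra F K]

instance : AddCommGroup (Coind X K) := inferInstanceAs (AddCommGroup (List X → K))

instance : Module F (Coind X K) := inferInstanceAs (Module F (List X → K))

/-- Shift by a letter. -/
def sh (a : X) (f : Coind X K) : Coind X K := fun l => f (a :: l)

/-- The shuffle bracket. -/
def br : List X → Coind X K → Coind X K → K
  | [], f, g => ⁅f [], g []⁆
  | a :: l, f, g => br l (sh a f) g + br l f (sh a g)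

theorem sh_add (a : X) (f g : Coind X K) : sh a (f + g) = sh a f + sh a g := rfl

theorem sh_smul (a : X) (t : F) (f : Coind X K) : sh a (t • f) = t • sh a f := rfl

theorem add_br (l : List X) : ∀ f g h : Coind X K, br l (f + g) h = br l f h + br l g h := by
  induction l with
  | nil => intro f g h; exact add_lie _ _ _
  | cons a l ih => intro f g h; simp only [br, sh_add, ih]; abel

theorem br_add (l : List X) : ∀ f g h : Coind X K, br l f (g + h) = br l f g + br l f h := by
  induction l with
  | nil => intro f g h; exact lie_add _ _ _
  | cons a l ih => intro f g h; simp only [br, sh_add, ih]; abel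

theorem br_smul (l : List X) :
    ∀ (t : F) (f g : Coind X K), br l f (t • g) = t • br l f g := by
  induction l with
  | nil => intro t f g; exact lie_smul _ _ _
  | cons a l ih => intro t f g; simp only [br, sh_smul, ih, smul_add]

theorem br_skew (l : List X) : ∀ f g : Coind X K, br l f g = - br l g f := by
  induction l with
  | nil => intro f g; exact (lie_skew _ _).symm
  | cons a l ih =>
    intro f g
    simp only [br]
    rw [ih (sh a f) g, ih f (sh a g)]; abel

theorem br_self (l : List X) : ∀ f : Coind X K, br l f f = 0 := by
  cases l with
  | nil => intro f; exact lie_self _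
  | cons a l => intro f; simp only [br]; rw [br_skew l (sh a f) f]; abel

instance : Bracket (Coind X K) (Coind X K) := ⟨fun f g l => br l f g⟩

theorem sh_lie (a : X) (f g : Coind X K) : sh a ⁅f, g⁆ = ⁅sh a f, g⁆ + ⁅f, sh a g⁆ := rfl

theorem br_jacobi (l : List X) : ∀ f g h : Coind X K,
    br l f ⁅g, h⁆ = br l ⁅f, g⁆ h + br l g ⁅f, h⁆ := by
  induction l with
  | nil => intro f g h; exact leibniz_lie _ _ _
  | cons a l ih =>
    intro f g h
    simp only [br, sh_lie, br_add, add_br]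
    rw [ih (sh a f) g h, ih f (sh a g) h, ih f g (sh a h)]
    abel

instance : LieRing (Coind X K) where
  add_lie f g h := funext fun l => add_br l f g h
  lie_add f g h := funext fun l => br_add l f g h
  lie_self f := funext fun l => br_self l f
  leibniz_lie f g h := funext fun l => br_jacobi l f g h

instance : LieAlgebra F (Coind X K) where
  lie_smul t f g := funext fun l => br_smul l t f g

theorem lie_nil (f g : Coind X K) : (⁅f, g⁆ : Coind X K) [] = ⁅f [], g []⁆ := rfl

variable (F K) in
/-- The shift as a derivation. -/
def shD (a : X) : LieDerivation F (Coind X K) (Coind X K) where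
  toFun := sh a
  map_add' _ _ := rfl
  map_smul' _ _ := rfl
  leibniz' f g := by
    change sh a ⁅f, g⁆ = ⁅f, sh a g⁆ - ⁅g, sh a f⁆
    rw [sh_lie, ← lie_skew (sh a f) g]; abel

theorem shD_apply (a : X) (f : Coind X K) : shD F K a f = sh a f := rfl

/-- Iterated action of a word. -/
def act {M : Type*} [AddCommGroup M] [Module F M] (e : X → M →ₗ[F] M) : List X → M →ₗ[F] M
  | [] => LinearMap.id
  | a :: l => act e l ∘ₗ e a

/-- The universal map into the coinduced module. -/
def uni {M : Type*} [AddCommGroup M] [Module F M] (e : X → M →ₗ[F] M) (g : M →ₗ[F] K) :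
    M →ₗ[F] Coind X K where
  toFun m := fun l => g (act e l m)
  map_add' m n := funext fun l => by
    change _ = g _ + g _
    simp
  map_smul' t m := funext fun l => by
    change _ = t • g _
    simp

end Coind

/-- elimination theorem: let `𝔩` be the free Lie algebra on the vector
space `V ⊕ W` (characterized by its universal property).  Let `F(W)` be the Lie
subalgebra generated by `W`, `I` the Lie ideal generated by `V`, and `T(W)·V` the
`T(W)`-submodule generated by `V` under the adjoint action.  Then `𝔩 = I ⊕ F(W)` as
vector spaces, `I` equals the Lie subalgebra generated by `T(W)·V`, and `I` is the free
Lie algebra on the vector space `T(W)·V` (universal property). -/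
theorem elimination_theorem
    (F : Type*) (V W 𝔩 : Type u) [Field F] [AddCommGroup V] [Module F V]
    [AddCommGroup W] [Module F W] [LieRing 𝔩] [LieAlgebra F 𝔩]
    (ι : V × W →ₗ[F] 𝔩)
    (hUP : ∀ (K : Type u) (_ : LieRing K) (_ : LieAlgebra F K) (g : V × W →ₗ[F] K),
      ∃! φ : 𝔩 →ₗ⁅F⁆ K, ∀ x, φ (ι x) = g x)
    (FW : LieSubalgebra F 𝔩)
    (hFW : FW = LieSubalgebra.lieSpan F 𝔩 (Set.range (ι ∘ₗ LinearMap.inr F V W)))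
    (I : LieIdeal F 𝔩)
    (hI : I = LieSubmodule.lieSpan F 𝔩
      ((LinearMap.range (ι ∘ₗ LinearMap.inl F V W) : Submodule F 𝔩) : Set 𝔩))
    (TWV : Submodule F 𝔩)
    (hTWV : TWV = sInf {p : Submodule F 𝔩 |
      LinearMap.range (ι ∘ₗ LinearMap.inl F V W) ≤ p ∧
      ∀ (w : W), ∀ c ∈ p, ⁅ι ((LinearMap.inr F V W) w), c⁆ ∈ p}) :
    (LieSubmodule.toSubmodule I) ⊓ (LieSubalgebra.toSubmodule FW) = ⊥ ∧
    (LieSubmodule.toSubmodule I) ⊔ (LieSubalgebra.toSubmodule FW) = ⊤ ∧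
    LieSubmodule.toSubmodule I =
      LieSubalgebra.toSubmodule (LieSubalgebra.lieSpan F 𝔩 (TWV : Set 𝔩)) ∧
    (∀ (K : Type u) (_ : LieRing K) (_ : LieAlgebra F K) (g : TWV →ₗ[F] K),
      ∃! ψ : (LieSubalgebra.lieSpan F 𝔩 (TWV : Set 𝔩)) →ₗ⁅F⁆ K,
        ∀ (w : 𝔩) (hw : w ∈ TWV),
          ψ ⟨w, LieSubalgebra.subset_lieSpan hw⟩ = g ⟨w, hw⟩) := by
  have hV : ∀ v : V, ι (v, 0) ∈ LinearMap.range (ι ∘ₗ LinearMap.inl F V W) :=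
    fun v => ⟨v, rfl⟩
  have hsplit : ∀ x : V × W, ι x = ι (x.1, 0) + ι (0, x.2) := by
    intro x; rw [← map_add]; simp
  -- generation
  have hgen : ∀ A : LieSubalgebra F 𝔩, (∀ v : V, ι (v, 0) ∈ A) → (∀ w : W, ι (0, w) ∈ A) →
      ∀ x, x ∈ A := by
    intro A h1 h2 x
    have h3 : ∀ y, ι y ∈ A := fun y => by
      rw [hsplit]; exact add_mem (h1 _) (h2 _)
    obtain ⟨φ, hφ, -⟩ := hUP A inferInstance inferInstance
      (LinearMap.codRestrict A.toSubmodule ι h3)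
    obtain ⟨θ, -, hθ⟩ := hUP 𝔩 inferInstance inferInstance ι
    have e1 : A.incl.comp φ = θ := hθ _ fun y => by
      rw [LieHom.comp_apply, hφ]; rfl
    have e2 : LieHom.id = θ := hθ _ fun y => rfl
    have e3 : A.incl (φ x) = x := by
      have := LieHom.congr_fun (e1.trans e2.symm) x
      simpa using this
    rw [← e3]; exact (φ x).2
  have hVI : ∀ v : V, ι (v, 0) ∈ I := fun v => by
    rw [hI]; exact LieSubmodule.subset_lieSpan (hV v)
  have hWFW : ∀ w : W, ι (0, w) ∈ FW := fun w => by
    rw [hFW]; exact LieSubalgebra.subset_lieSpan ⟨w, rfl⟩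
  -- properties of `TWV`
  have hTV : ∀ v : V, ι (v, 0) ∈ TWV := fun v => by
    rw [hTWV, Submodule.mem_sInf]; exact fun p hp => hp.1 (hV v)
  have hTW : ∀ w : W, ∀ c ∈ TWV, ⁅ι (0, w), c⁆ ∈ TWV := by
    intro w c hc
    rw [hTWV, Submodule.mem_sInf] at hc ⊢
    exact fun p hp => hp.2 w c (hc p hp)
  have hTle : ∀ p : Submodule F 𝔩, (∀ v : V, ι (v, 0) ∈ p) →
      (∀ w : W, ∀ c ∈ p, ⁅ι (0, w), c⁆ ∈ p) → TWV ≤ p := by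
    intro p h1 h2
    rw [hTWV]
    refine sInf_le ⟨?_, h2⟩
    rintro _ ⟨v, rfl⟩
    exact h1 v
  clear hTWV
  refine ⟨?_, ?_, ?_, ?_⟩
  · obtain ⟨p, hp, -⟩ := hUP 𝔩 inferInstance inferInstance
      (ι ∘ₗ LinearMap.inr F V W ∘ₗ LinearMap.snd F V W)
    have h1 : I ≤ p.ker := by
      rw [hI, LieSubmodule.lieSpan_le]
      rintro _ ⟨v, rfl⟩
      change _ ∈ p.ker
      rw [LieHom.mem_ker]
      have := hp (v, 0)
      exact this.trans (map_zero (ι ∘ₗ LinearMap.inr F V W))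
    rw [eq_bot_iff]
    rintro x ⟨hx1, hx2⟩
    have hx1' : p x = 0 := LieHom.mem_ker.1 (h1 hx1)
    have hx2' : p x = x := by
      have hx3 : x ∈ LieSubalgebra.lieSpan F 𝔩 (Set.range (ι ∘ₗ LinearMap.inr F V W)) := by
        rw [← hFW]; exact hx2
      clear hx1 hx2 hx1'
      induction hx3 using LieSubalgebra.lieSpan_induction with
      | mem y hy =>
        obtain ⟨w, rfl⟩ := hy
        have := hp (0, w)
        simpa using this
      | zero => simp
      | add y z hy hz h1 h2 => rw [map_add, h1, h2]
      | smul a y hy h1 => rw [map_smul, h1]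
      | lie y z hy hz h1 h2 => rw [LieHom.map_lie, h1, h2]
    rw [Submodule.mem_bot, ← hx2', hx1']
  · let A : LieSubalgebra F 𝔩 :=
      { (LieSubmodule.toSubmodule I) ⊔ (LieSubalgebra.toSubmodule FW) with
        lie_mem' := by
          intro x y hx hy
          change x ∈ (LieSubmodule.toSubmodule I) ⊔ (LieSubalgebra.toSubmodule FW) at hx
          change y ∈ (LieSubmodule.toSubmodule I) ⊔ (LieSubalgebra.toSubmodule FW) at hy
          change ⁅x, y⁆ ∈ (LieSubmodule.toSubmodule I) ⊔ (LieSubalgebra.toSubmodule FW)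
          obtain ⟨a, ha, b, hb, rfl⟩ := Submodule.mem_sup.1 hx
          obtain ⟨c, hc, d, hd, rfl⟩ := Submodule.mem_sup.1 hy
          refine Submodule.mem_sup.2 ⟨⁅a, c + d⁆ + ⁅b, c⁆, ?_, ⁅b, d⁆, ?_, ?_⟩
          · exact add_mem (lie_mem_left F 𝔩 I _ _ ha) (lie_mem_right F 𝔩 I _ _ hc)
          · exact FW.lie_mem hb hd
          · rw [add_lie, lie_add b]; abel }
    rw [eq_top_iff]
    intro x _
    exact hgen A (fun v => Submodule.mem_sup_left (hVI v))
      (fun w => Submodule.mem_sup_right (hWFW w)) x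
  · apply le_antisymm
    · let S := LieSubalgebra.lieSpan F 𝔩 (TWV : Set 𝔩)
      have hWS : ∀ w : W, ∀ y ∈ S, ⁅ι (0, w), y⁆ ∈ S := by
        intro w y hy
        induction hy using LieSubalgebra.lieSpan_induction with
        | mem y hy => exact LieSubalgebra.subset_lieSpan (hTW w y hy)
        | zero => simp
        | add y z hy hz h1 h2 => rw [lie_add]; exact add_mem h1 h2
        | smul a y hy h1 => rw [lie_smul]; exact S.smul_mem a h1
        | lie y z hy hz h1 h2 =>
          rw [leibniz_lie]; exact add_mem (S.lie_mem h1 hz) (S.lie_mem hy h2)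
      have hall : ∀ x : 𝔩, x ∈ S.normalizer := by
        apply hgen
        · intro v
          exact LieSubalgebra.le_normalizer _ (LieSubalgebra.subset_lieSpan (hTV v))
        · intro w
          rw [LieSubalgebra.mem_normalizer_iff]
          exact hWS w
      let J : LieIdeal F 𝔩 :=
        { S.toSubmodule with
          lie_mem := fun {x m} hm => (LieSubalgebra.mem_normalizer_iff S x).1 (hall x) m hm }
      have hIJ : I ≤ J := by
        rw [hI, LieSubmodule.lieSpan_le]
        rintro _ ⟨v, rfl⟩
        exact LieSubalgebra.subset_lieSpan (hTV v)
      exact hIJ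
    · have : LieSubalgebra.lieSpan F 𝔩 (TWV : Set 𝔩) ≤ LieIdeal.toLieSubalgebra F 𝔩 I := by
        rw [LieSubalgebra.lieSpan_le]
        exact hTle (LieSubmodule.toSubmodule I) hVI fun w c hc => lie_mem_right F 𝔩 I _ _ hc
      exact this
  · intro K _ _ g
    let b := Module.Basis.ofVectorSpace F W
    let ad : W → TWV →ₗ[F] TWV := fun w =>
      ((LieAlgebra.ad F 𝔩 (ι (0, w)) : 𝔩 →ₗ[F] 𝔩)).restrict (hTW w)
    let G : TWV →ₗ[F] Coind (Module.Basis.ofVectorSpaceIndex F W) K :=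
      Coind.uni (fun a => ad (b a)) g
    let D : W →ₗ[F] LieDerivation F (Coind (Module.Basis.ofVectorSpaceIndex F W) K)
        (Coind (Module.Basis.ofVectorSpaceIndex F W) K) := b.constr F (Coind.shD F K)
    let χ := (LieHom.id : LieDerivation F (Coind (Module.Basis.ofVectorSpaceIndex F W) K)
        (Coind (Module.Basis.ofVectorSpaceIndex F W) K) →ₗ⁅F⁆ _)
    let G' : V →ₗ[F] TWV := (ι ∘ₗ LinearMap.inl F V W).codRestrict TWV hTV
    have hDG : ∀ (w : W) (m : TWV), D w (G m) = G (ad w m) := by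
      intro w m
      have adadd : ∀ w w', ad (w + w') m = ad w m + ad w' m := by
        intro w w'
        ext
        change ⁅ι (0, w + w'), (m : 𝔩)⁆ = ⁅ι (0, w), (m : 𝔩)⁆ + ⁅ι (0, w'), (m : 𝔩)⁆
        rw [← add_lie, ← map_add]; simp
      have adsmul : ∀ (t : F) w, ad (t • w) m = t • ad w m := by
        intro t w
        ext
        change ⁅ι (0, t • w), (m : 𝔩)⁆ = t • ⁅ι (0, w), (m : 𝔩)⁆
        rw [← smul_lie, ← map_smul]; simp
      let L1 : W →ₗ[F] Coind (Module.Basis.ofVectorSpaceIndex F W) K :=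
        { toFun := fun w => D w (G m)
          map_add' := fun x y => by rw [map_add]; rfl
          map_smul' := fun t x => by rw [map_smul]; rfl }
      let L2 : W →ₗ[F] Coind (Module.Basis.ofVectorSpaceIndex F W) K :=
        { toFun := fun w => G (ad w m)
          map_add' := fun x y => by rw [adadd, map_add]
          map_smul' := fun t x => by rw [adsmul, map_smul]; rfl }
      have : L1 = L2 := b.ext fun a => by
        change D (b a) (G m) = G (ad (b a) m)
        rw [Module.Basis.constr_basis]
        rfl
      exact LinearMap.congr_fun this w
    obtain ⟨Φ, hΦ, -⟩ := hUP (LieAlgebra.SemiDirectSum _ _ χ) inferInstance inferInstance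
      (LinearMap.coprod ((LieAlgebra.SemiDirectSum.inl χ : _ →ₗ[F] _) ∘ₗ G ∘ₗ G')
        ((LieAlgebra.SemiDirectSum.inr χ : _ →ₗ[F] _) ∘ₗ D))
    have hΦV : ∀ v, Φ (ι (v, 0)) = ⟨G ⟨_, hTV v⟩, 0⟩ := by
      intro v
      rw [hΦ, LinearMap.coprod_apply, map_zero, add_zero]; rfl
    have hΦW : ∀ w, Φ (ι (0, w)) = ⟨0, D w⟩ := by
      intro w
      rw [hΦ, LinearMap.coprod_apply, map_zero, zero_add]; rfl
    have hΦT : ∀ m : 𝔩, ∀ h : m ∈ TWV, Φ m = ⟨G ⟨m, h⟩, 0⟩ := by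
      let E : Submodule F TWV := LinearMap.eqLocus ((Φ : 𝔩 →ₗ[F] _) ∘ₗ TWV.subtype)
        ((LieAlgebra.SemiDirectSum.inl χ).toLinearMap ∘ₗ G)
      have hle : TWV ≤ E.map TWV.subtype := by
        apply hTle
        · intro v
          exact ⟨⟨_, hTV v⟩, hΦV v, rfl⟩
        · rintro w _ ⟨m, hm, rfl⟩
          refine ⟨ad w m, ?_, rfl⟩
          have hm' : Φ (m : 𝔩) = ⟨G m, 0⟩ := hm
          change Φ ⁅ι (0, w), (m : 𝔩)⁆ = ⟨G (ad w m), 0⟩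
          rw [LieHom.map_lie, hm', hΦW, LieAlgebra.SemiDirectSum.lie_eq_mk, ← hDG]
          have : χ (D w) (G m) = D w (G m) := rfl
          simp [this]
      intro m h
      obtain ⟨m', hm', e⟩ := hle h
      subst e
      exact hm'
    have hright : ∀ x ∈ LieSubalgebra.lieSpan F 𝔩 (TWV : Set 𝔩), (Φ x).right = 0 := by
      have : LieSubalgebra.lieSpan F 𝔩 (TWV : Set 𝔩) ≤ LieIdeal.toLieSubalgebra F 𝔩
          ((LieAlgebra.SemiDirectSum.projr χ).comp Φ).ker := by
        rw [LieSubalgebra.lieSpan_le]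
        intro m hm
        change m ∈ ((LieAlgebra.SemiDirectSum.projr χ).comp Φ).ker
        rw [LieHom.mem_ker, LieHom.comp_apply, hΦT m hm]
        rfl
      intro x hx
      have h2 : x ∈ ((LieAlgebra.SemiDirectSum.projr χ).comp Φ).ker := this hx
      rwa [LieHom.mem_ker] at h2
    let ψ : (LieSubalgebra.lieSpan F 𝔩 (TWV : Set 𝔩)) →ₗ⁅F⁆ K :=
      { toFun := fun x => (Φ x).left []
        map_add' := fun x y => by
          
          change (Φ ((x : 𝔩) + (y : 𝔩))).left [] = _
          rw [map_add]; rfl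
        map_smul' := fun t x => by
          
          change (Φ (t • (x : 𝔩))).left [] = _
          rw [map_smul]; rfl
        map_lie' := fun {x y} => by
          change (Φ ((⁅x, y⁆ : LieSubalgebra.lieSpan F 𝔩 (TWV : Set 𝔩)) : 𝔩)).left [] =
            ⁅(Φ x).left [], (Φ y).left []⁆
          rw [LieSubalgebra.coe_bracket, LieHom.map_lie, LieAlgebra.SemiDirectSum.lie_eq_mk,
            hright _ x.2, hright _ y.2]
          simp [Coind.lie_nil] }
    refine ⟨ψ, ?_, ?_⟩
    · intro w hw
      change (Φ w).left [] = _
      rw [hΦT w hw]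
      rfl
    · intro θ hθ
      ext ⟨x, hx⟩
      change θ ⟨x, hx⟩ = ψ ⟨x, hx⟩
      induction hx using LieSubalgebra.lieSpan_induction with
      | mem y hy =>
        rw [hθ y hy]
        change _ = (Φ y).left []
        rw [hΦT y hy]
        rfl
      | zero => exact (map_zero θ).trans (map_zero ψ).symm
      | add y z hy hz h1 h2 =>
        have := map_add θ ⟨y, hy⟩ ⟨z, hz⟩
        have h' := map_add ψ ⟨y, hy⟩ ⟨z, hz⟩
        rw [h1, h2, ← h'] at this
        exact this
      | smul a y hy h1 =>
        have := map_smul θ a ⟨y, hy⟩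
        have h' := map_smul ψ a ⟨y, hy⟩
        rw [h1, ← h'] at this
        exact this
      | lie y z hy hz h1 h2 =>
        have := LieHom.map_lie θ ⟨y, hy⟩ ⟨z, hz⟩
        have h' := LieHom.map_lie ψ ⟨y, hy⟩ ⟨z, hz⟩
        rw [h1, h2, ← h'] at this
        exact this
end
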